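/- arXiv:2401.15637 — 2 statements merged into one kernel-verified Lean document; each statement's English description precedes it below -/
import Mathlib

section
/- Let N = 4. As ε → 0⁺, ∫_{ℝ⁴_+} K(x)|∇Ũ_ε(x)|² dx = K₁ + (k₄² ω₄ / 2) ε² |log ε| + O(ε²), where ω₄ = 2π² is the surface area of the unit sphere in ℝ⁴ and k₄ = (4·2)^{1/2} = √8 (so the coefficient equals 8π²). -/
open MeasureTheory Real Topology Filter

noncomputable section

/-- `ℝ^N` as Euclidean space. -/
abbrev Euc (N : ℕ) := EuclideanSpace ℝ (Fin N)

/-- Gaussian-type weight `K(x) = exp(|x|²/4)`. -/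
noncomputable def Kw {N : ℕ} (x : Euc N) : ℝ := Real.exp (‖x‖ ^ 2 / 4)

/-- critical Sobolev exponent `2* = 2N/(N-2)` -/
noncomputable def twoStar (N : ℕ) : ℝ := 2 * (N : ℝ) / ((N : ℝ) - 2)

/-- critical trace exponent `2_* = 2(N-1)/(N-2)` -/
noncomputable def twoStarL (N : ℕ) : ℝ := 2 * ((N : ℝ) - 1) / ((N : ℝ) - 2)

/-- `i`-th partial derivative of `u` at `x` -/
noncomputable def pd {N : ℕ} (u : Euc N → ℝ) (i : Fin N) (x : Euc N) : ℝ :=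
  fderiv ℝ u x (EuclideanSpace.single i 1)

/-- `|∇u(x)|²` -/
noncomputable def gradSq {N : ℕ} (u : Euc N → ℝ) (x : Euc N) : ℝ :=
  ∑ i, (pd u i x) ^ 2

/-- `x · ∇u(x)` -/
noncomputable def radial {N : ℕ} (u : Euc N → ℝ) (x : Euc N) : ℝ :=
  ∑ i, x i * pd u i x

/-- Laplacian `Δu(x)` -/
noncomputable def lap {N : ℕ} (u : Euc N → ℝ) (x : Euc N) : ℝ :=
  ∑ i, pd (pd u i) i x

/-- index of the vertical coordinate `x_N` -/
def lastIdx (N : ℕ) (h : 0 < N) : Fin N := ⟨N - 1, by omega⟩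

/-- open upper half-space `ℝ^N_+` -/
def upperHS (N : ℕ) (h : 0 < N) : Set (Euc N) := {x | 0 < x (lastIdx N h)}

/-- closed upper half-space -/
def upperHSc (N : ℕ) (h : 0 < N) : Set (Euc N) := {x | 0 ≤ x (lastIdx N h)}

/-- boundary hyperplane `∂ℝ^N_+` -/
def bdryHS (N : ℕ) (h : 0 < N) : Set (Euc N) := {x | x (lastIdx N h) = 0}

/-- vertical derivative `∂u/∂x_N`, taken within the closed half-space -/
noncomputable def pdN (N : ℕ) (h : 0 < N) (u : Euc N → ℝ) (x : Euc N) : ℝ :=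
  fderivWithin ℝ u (upperHSc N h) x (EuclideanSpace.single (lastIdx N h) 1)

/-- embedding of `ℝ^{N-1}` as the boundary of the half-space, `y ↦ (y, 0)` -/
noncomputable def emb (N : ℕ) (y : Euc (N - 1)) : Euc N :=
  (EuclideanSpace.equiv (Fin N) ℝ).symm
    (fun i => if hi : (i : ℕ) < N - 1 then y ⟨(i : ℕ), hi⟩ else 0)

/-- finite weighted energy, i.e. membership in the space `X` -/
def FiniteEnergy (N : ℕ) (h : 0 < N) (u : Euc N → ℝ) : Prop :=
  IntegrableOn (fun x => Kw x * (gradSq u x + (u x) ^ 2)) (upperHS N h)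

/-- classical solution of problem (1.1) -/
structure IsClassicalSolution (N : ℕ) (h : 0 < N) (lam mu p : ℝ) (u : Euc N → ℝ) : Prop where
  smooth2 : ContDiffOn ℝ 2 u (upperHS N h)
  smooth1 : ContDiffOn ℝ 1 u (upperHSc N h)
  pde : ∀ x ∈ upperHS N h,
    -lap u x - (1 / 2) * radial u x
      = lam * |u x| ^ (twoStar N - 2) * u x + mu * |u x| ^ (p - 2) * u x
  bc : ∀ x ∈ bdryHS N h,
    -pdN N h u x = Real.sqrt lam * |u x| ^ (twoStarL N - 2) * u x

/-- `x_N⁰ = √(N/(N-2))` -/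
noncomputable def xN0 (N : ℕ) : ℝ := Real.sqrt ((N : ℝ) / ((N : ℝ) - 2))

/-- `k_N = (N(N-2))^{(N-2)/4}` -/
noncomputable def kN (N : ℕ) : ℝ := ((N : ℝ) * ((N : ℝ) - 2)) ^ (((N : ℝ) - 2) / 4)

/-- `|x'|²`, squared norm of the horizontal part -/
noncomputable def horizSq {N : ℕ} (h : 0 < N) (x : Euc N) : ℝ :=
  ∑ i ∈ Finset.univ.erase (lastIdx N h), (x i) ^ 2

/-- the family `φ_{ε,τ}` -/
noncomputable def bubbleT (N : ℕ) (h : 0 < N) (ε τ : ℝ) (x : Euc N) : ℝ :=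
  (ε * Real.sqrt ((N : ℝ) * ((N : ℝ) - 2)) /
      (ε ^ 2 + horizSq h x + (x (lastIdx N h) + ε * τ * xN0 N) ^ 2)) ^ (((N : ℝ) - 2) / 2)

/-- the boundary bubble `U_ε = φ_{ε,1}` -/
noncomputable def Ubub (N : ℕ) (h : 0 < N) (ε : ℝ) (x : Euc N) : ℝ := bubbleT N h ε 1 x

/-- `K₁ = ∫_{ℝ^N_+} |∇U_ε|²` (an `ε`-independent constant, computed at `ε = 1`) -/
noncomputable def Kone (N : ℕ) (h : 0 < N) : ℝ :=
  ∫ x in upperHS N h, gradSq (Ubub N h 1) x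

/-- `K₂ = ∫_{ℝ^N_+} U_ε^{2*}` -/
noncomputable def Ktwo (N : ℕ) (h : 0 < N) : ℝ :=
  ∫ x in upperHS N h, (Ubub N h 1 x) ^ twoStar N

/-- `K₃ = ∫_{ℝ^{N-1}} U_ε(x',0)^{2_*}` -/
noncomputable def Kthree (N : ℕ) (h : 0 < N) : ℝ :=
  ∫ y : Euc (N - 1), (Ubub N h 1 (emb N y)) ^ twoStarL N

/-- cut-off function: `φ ∈ C_c^∞(ℝ^N,[0,1])`, `φ ≡ 1` on `B₁(0)`, `φ ≡ 0` outside `B₂(0)` -/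
structure IsCutoff (N : ℕ) (φ : Euc N → ℝ) : Prop where
  smooth : ContDiff ℝ (⊤ : ℕ∞) φ
  mem01 : ∀ x, φ x ∈ Set.Icc (0 : ℝ) 1
  eq_one : ∀ x ∈ Metric.closedBall (0 : Euc N) 1, φ x = 1
  eq_zero : ∀ x ∉ Metric.ball (0 : Euc N) 2, φ x = 0

/-- truncated weighted bubble `Ũ_ε = K^{-1/2} φ U_ε` -/
noncomputable def Ut (N : ℕ) (h : 0 < N) (φ : Euc N → ℝ) (ε : ℝ) (x : Euc N) : ℝ :=
  (Kw x) ^ (-(1 : ℝ) / 2) * φ x * Ubub N h ε x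

/-- smooth compactly supported test functions on the closed half-space -/
structure IsTestFun (N : ℕ) (h : 0 < N) (u : Euc N → ℝ) : Prop where
  smooth : ContDiff ℝ (⊤ : ℕ∞) u
  cpt : HasCompactSupport u
  supp : tsupport u ⊆ upperHSc N h

/-- the norm of the space `X`: `‖u‖ = (∫ K |∇u|²)^{1/2}` -/
noncomputable def Xnorm (N : ℕ) (h : 0 < N) (u : Euc N → ℝ) : ℝ :=
  Real.sqrt (∫ x in upperHS N h, Kw x * gradSq u x)


abbrev HH : Set (Euc 4) := upperHS 4 (by norm_num : 0 < 4)

/-- last coordinate -/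
def p3 : Euc 4 →L[ℝ] ℝ := EuclideanSpace.proj (3 : Fin 4)

/-- the denominator -/
def DD (ε : ℝ) (x : Euc 4) : ℝ := ‖x‖ ^ 2 + 2 * √2 * ε * x 3 + 3 * ε ^ 2

lemma nsq (x : Euc 4) : ‖x‖ ^ 2 = ∑ i, x i ^ 2 := by
  rw [EuclideanSpace.norm_sq_eq]; simp

lemma DD_eq (ε : ℝ) (x : Euc 4) :
    DD ε x = ε ^ 2 + (x 0 ^ 2 + x 1 ^ 2 + x 2 ^ 2) + (x 3 + ε * √2) ^ 2 := by
  have : √2 ^ 2 = 2 := Real.sq_sqrt (by norm_num)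
  rw [DD, nsq, Fin.sum_univ_four]
  linear_combination (-ε ^ 2) * this

lemma DD_pos {ε : ℝ} (hε : 0 < ε) (x : Euc 4) : 0 < DD ε x := by
  rw [DD_eq]; positivity

lemma Ubub_eq (h : 0 < 4) (ε : ℝ) : Ubub 4 h ε = fun x => ε * √8 / DD ε x := by
  funext x
  have h1 : Finset.univ.erase (lastIdx 4 h) = {0, 1, 2} := by decide +revert
  have h2 : x (lastIdx 4 h) = x 3 := rfl
  have h3 : ((4 : ℕ) : ℝ) = 4 := by norm_num
  rw [Ubub, bubbleT, horizSq, h1, h2, DD_eq, h3, xN0, h3]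
  have h4 : ((4:ℝ) - 2) / 2 = 1 := by norm_num
  have h5 : ((4:ℝ) * (4 - 2)) = 8 := by norm_num
  have h6 : ((4:ℝ) / (4 - 2)) = 2 := by norm_num
  rw [h4, h5, h6, Real.rpow_one]
  simp [Finset.sum_insert]
  ring_nf

/-- derivative of the denominator -/
def dD (ε : ℝ) (i : Fin 4) (x : Euc 4) : ℝ := 2 * x i + (if i = 3 then 2 * √2 * ε else 0)

lemma hasFD_norm (x : Euc 4) : HasFDerivAt (fun x : Euc 4 => ‖x‖ ^ 2) (2 • innerSL ℝ x) x :=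
  (hasStrictFDerivAt_norm_sq x).hasFDerivAt

lemma hasFD_DD (ε : ℝ) (x : Euc 4) : HasFDerivAt (DD ε)
    (2 • innerSL ℝ x + (2 * √2 * ε) • p3) x := by
  have h2 : HasFDerivAt (fun x : Euc 4 => x 3)
    (p3) x :=
    (p3).hasFDerivAt
  exact ((hasFD_norm x).add (h2.const_mul (2 * √2 * ε))).add_const _

lemma contDiff_DD (ε : ℝ) : ContDiff ℝ 1 (DD ε) := by
  unfold DD
  have h2 : ContDiff ℝ 1 (fun x : Euc 4 => x 3) :=
    (p3).contDiff
  exact ((contDiff_norm_sq ℝ).add (contDiff_const.mul h2)).add contDiff_const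

lemma contDiff_U (h : 0 < 4) {ε : ℝ} (hε : 0 < ε) : ContDiff ℝ 1 (Ubub 4 h ε) := by
  rw [Ubub_eq]
  exact contDiff_const.div (contDiff_DD ε) (fun x => (DD_pos hε x).ne')

lemma pd_DD (ε : ℝ) (i : Fin 4) (x : Euc 4) : pd (DD ε) i x = dD ε i x := by
  rw [pd, (hasFD_DD ε x).fderiv, dD]
  simp [EuclideanSpace.inner_single_right, eq_comm, p3]

lemma pd_U (h : 0 < 4) {ε : ℝ} (hε : 0 < ε) (i : Fin 4) (x : Euc 4) :
    pd (Ubub 4 h ε) i x = -(ε * √8 * dD ε i x / DD ε x ^ 2) := by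
  have h1 := ((hasDerivAt_inv (DD_pos hε x).ne').comp_hasFDerivAt x (hasFD_DD ε x)).const_mul (ε * √8)
  have h2 : Ubub 4 h ε = fun x => (ε * √8) * ((fun y => y⁻¹) ∘ DD ε) x := by
    rw [Ubub_eq]; funext x; simp [div_eq_mul_inv]
  rw [pd, h2, h1.fderiv, ← pd_DD, pd, (hasFD_DD ε x).fderiv]
  simp only [_root_.smul_apply, smul_eq_mul]
  ring

lemma Ut_eq (h : 0 < 4) (φ : Euc 4 → ℝ) (ε : ℝ) :
    Ut 4 h φ ε = fun x => Real.exp (-(1/8) * ‖x‖ ^ 2) * φ x * Ubub 4 h ε x := by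
  funext x
  rw [Ut, Kw, ← Real.exp_mul]
  ring_nf

lemma pd_Ut (h : 0 < 4) {φ : Euc 4 → ℝ} (hφ : ContDiff ℝ 1 φ) {ε : ℝ} (hε : 0 < ε) (i : Fin 4)
    (x : Euc 4) :
    pd (Ut 4 h φ ε) i x = Real.exp (-(1/8) * ‖x‖ ^ 2) *
      (-(x i / 4) * φ x * Ubub 4 h ε x + pd φ i x * Ubub 4 h ε x + φ x * pd (Ubub 4 h ε) i x) := by
  have h1 := ((hasFD_norm x).const_mul (-(1/8))).exp
  have h2 := (hφ.differentiable one_ne_zero x).hasFDerivAt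
  have h3 := ((contDiff_U h hε).differentiable one_ne_zero x).hasFDerivAt
  have h4 : HasFDerivAt (fun x => Real.exp (-(1/8) * ‖x‖ ^ 2) * φ x * Ubub 4 h ε x) _ x :=
    (h1.mul h2).mul h3
  rw [pd, Ut_eq, h4.fderiv, pd, pd]
  simp [EuclideanSpace.inner_single_right]
  ring

lemma Kw_gradSq (h : 0 < 4) {φ : Euc 4 → ℝ} (hφ : ContDiff ℝ 1 φ) {ε : ℝ} (hε : 0 < ε)
    (x : Euc 4) :
    Kw x * gradSq (Ut 4 h φ ε) x = ∑ i, 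
      (-(x i / 4) * φ x * Ubub 4 h ε x + pd φ i x * Ubub 4 h ε x
        + φ x * pd (Ubub 4 h ε) i x) ^ 2 := by
  simp_rw [gradSq, pd_Ut h hφ hε, mul_pow, ← Finset.mul_sum]
  rw [← mul_assoc, Kw, ← Real.exp_nat_mul, ← Real.exp_add]
  have : ‖x‖ ^ 2 / 4 + (2:ℕ) * (-(1/8) * ‖x‖ ^ 2) = 0 := by push_cast; ring
  rw [this]; simp

lemma gradSq_U (h : 0 < 4) {ε : ℝ} (hε : 0 < ε) (x : Euc 4) :
    gradSq (Ubub 4 h ε) x = 32 * ε ^ 2 * (DD ε x - ε ^ 2) / DD ε x ^ 4 := by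
  have h8 : √8 ^ 2 = 8 := Real.sq_sqrt (by norm_num)
  have h2 : √2 ^ 2 = 2 := Real.sq_sqrt (by norm_num)
  have hs : ∑ i, dD ε i x ^ 2 = 4 * (DD ε x - ε ^ 2) := by
    rw [DD, nsq, Fin.sum_univ_four, Fin.sum_univ_four]
    simp [dD]
    linear_combination 4 * ε ^ 2 * h2
  simp_rw [gradSq, pd_U h hε, neg_sq, div_pow, mul_pow, ← Finset.sum_div, ← Finset.mul_sum, hs, h8]
  ring

lemma cross_U (h : 0 < 4) {ε : ℝ} (hε : 0 < ε) (x : Euc 4) :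
    Ubub 4 h ε x * ∑ i, x i * pd (Ubub 4 h ε) i x
      = - (16 * ε ^ 2 * ((‖x‖ ^ 2 + √2 * ε * x 3) / DD ε x ^ 3)) := by
  have h8 : √8 ^ 2 = 8 := Real.sq_sqrt (by norm_num)
  have hs : ∑ i, x i * dD ε i x = 2 * (‖x‖ ^ 2 + √2 * ε * x 3) := by
    rw [nsq, Fin.sum_univ_four, Fin.sum_univ_four]
    simp [dD]
    ring
  have hs' : ∑ i, x i * pd (Ubub 4 h ε) i x = -(ε * √8 / DD ε x ^ 2) * ∑ i, x i * dD ε i x := by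
    rw [Finset.mul_sum]; simp_rw [pd_U h hε]
    exact Finset.sum_congr rfl (fun i _ => by ring)
  rw [hs', hs, Ubub_eq]
  have := (DD_pos hε x).ne'
  field_simp
  linear_combination (-2:ℝ) * (‖x‖ ^ 2 + √2 * ε * x 3) * h8

lemma scalar_far {ε r t s D : ℝ} (hε : 0 < ε) (hr : ε < r) (ht : 0 < t) (htr : t ≤ r)
    (hs0 : 0 ≤ s) (hs : s ≤ 3 / 2) (hD : D = r ^ 2 + 2 * s * ε * t + 3 * ε ^ 2) :
    |(r ^ 2 + s * ε * t) / D ^ 3 - (r ^ 4)⁻¹| ≤ 600 * (ε / (r + ε) ^ 5) := by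
  have hr0 : 0 < r := hε.trans hr
  have hst : s * ε * t ≤ 3 / 2 * ε * r := by
    apply mul_le_mul _ htr ht.le (by positivity)
    exact mul_le_mul_of_nonneg_right hs hε.le
  have hst0 : 0 ≤ s * ε * t := by positivity
  have hee : ε ^ 2 ≤ ε * r := by nlinarith
  have hDr : r ^ 2 ≤ D := by rw [hD]; nlinarith [sq_nonneg ε]
  have hD0 : 0 < D := lt_of_lt_of_le (by positivity) hDr
  have ha : D - r ^ 2 ≤ 6 * ε * r := by rw [hD]; nlinarith
  have h1 : |(r ^ 2 + s * ε * t) / D ^ 3 - (D ^ 2)⁻¹| ≤ 6 * ε / r ^ 5 := by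
    have : (r ^ 2 + s * ε * t) / D ^ 3 - (D ^ 2)⁻¹ = -((D - r ^ 2 - s * ε * t) / D ^ 3) := by
      field_simp; ring
    have h0 : 0 ≤ D - r ^ 2 - s * ε * t := by rw [hD]; nlinarith [sq_nonneg ε]
    rw [this, abs_neg, abs_of_nonneg (by positivity)]
    calc (D - r ^ 2 - s * ε * t) / D ^ 3 ≤ (6 * ε * r) / (r ^ 2) ^ 3 := by
          gcongr; linarith
      _ = 6 * ε / r ^ 5 := by field_simp
  have h2 : |(D ^ 2)⁻¹ - (r ^ 4)⁻¹| ≤ 12 * ε / r ^ 5 := by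
    have : (D ^ 2)⁻¹ - (r ^ 4)⁻¹ = -((D - r ^ 2) * (D + r ^ 2) / (D ^ 2 * r ^ 4)) := by
      field_simp; ring
    have h0 : 0 ≤ D - r ^ 2 := by linarith
    rw [this, abs_neg, abs_of_nonneg (by positivity)]
    calc (D - r ^ 2) * (D + r ^ 2) / (D ^ 2 * r ^ 4)
        ≤ (6 * ε * r) * (D + D) / (D ^ 2 * r ^ 4) := by gcongr
      _ = (12 * ε * r) / (D * r ^ 4) := by field_simp; ring
      _ ≤ (12 * ε * r) / (r ^ 2 * r ^ 4) := by gcongr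
      _ = 12 * ε / r ^ 5 := by field_simp
  have h3 : ε / r ^ 5 ≤ 32 * (ε / (r + ε) ^ 5) := by
    have : (r + ε) ^ 5 ≤ (2 * r) ^ 5 := by gcongr; linarith
    rw [div_le_iff₀ (by positivity), mul_assoc, div_mul_eq_mul_div, mul_div_assoc', 
      le_div_iff₀ (by positivity)]
    nlinarith
  have h4 : 6 * ε / r ^ 5 + 12 * ε / r ^ 5 = 18 * (ε / r ^ 5) := by ring
  have h5 : 0 ≤ ε / (r + ε) ^ 5 := by positivity
  have := abs_sub_le ((r ^ 2 + s * ε * t) / D ^ 3) ((D ^ 2)⁻¹) ((r ^ 4)⁻¹)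
  linarith

lemma scalar_near {ε r t s D : ℝ} (hε : 0 < ε) (hr0 : 0 < r) (hr : r ≤ ε) (ht : 0 < t)
    (hs0 : 0 ≤ s) (hD : D = r ^ 2 + 2 * s * ε * t + 3 * ε ^ 2) :
    |(r ^ 2 + s * ε * t) / D ^ 3| ≤ 600 * (ε / (r + ε) ^ 5) := by
  have hst0 : 0 ≤ s * ε * t := by positivity
  have hD1 : ε ^ 2 ≤ D := by rw [hD]; nlinarith [sq_nonneg r]
  have hD0 : 0 < D := lt_of_lt_of_le (by positivity) hD1
  rw [abs_of_nonneg (by positivity)]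
  calc (r ^ 2 + s * ε * t) / D ^ 3 ≤ D / D ^ 3 := by
        gcongr; rw [hD]; nlinarith [sq_nonneg ε]
    _ = 1 / D ^ 2 := by field_simp
    _ ≤ 1 / (ε ^ 2) ^ 2 := by gcongr
    _ = 32 * (ε / (2 * ε) ^ 5) := by field_simp; norm_num
    _ ≤ 32 * (ε / (r + ε) ^ 5) := by gcongr; linarith
    _ ≤ 600 * (ε / (r + ε) ^ 5) := by gcongr; norm_num

/-- logarithmic model term -/
def hh (ε : ℝ) (r : ℝ) : ℝ := if ε < r ∧ r < 1 then (r ^ 4)⁻¹ else 0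

/-- singular weight -/
def ww (r : ℝ) : ℝ := if r < 1 then (r ^ 2)⁻¹ else 0

/-- dominating function -/
def GG (ε : ℝ) (x : Euc 4) : ℝ :=
  ε / (‖x‖ + ε) ^ 5 + ww ‖x‖ + ((1 + ‖x‖) ^ 5)⁻¹

lemma coord_le (x : Euc 4) (i : Fin 4) : |x i| ≤ ‖x‖ := by
  simpa using PiLp.norm_apply_le x i

lemma sqrt2_le : √2 ≤ 3 / 2 := by
  rw [Real.sqrt_le_left (by norm_num)]; norm_num

lemma DD_ge {ε : ℝ} (hε : 0 < ε) {x : Euc 4} (hx : 0 < x 3) : ‖x‖ ^ 2 + 3 * ε ^ 2 ≤ DD ε x := by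
  rw [DD]
  have : 0 ≤ 2 * √2 * ε * x 3 := by positivity
  linarith

lemma gradSq_U_nonneg (h : 0 < 4) (ε : ℝ) (x : Euc 4) : 0 ≤ gradSq (Ubub 4 h ε) x :=
  Finset.sum_nonneg (fun i _ => sq_nonneg _)

lemma gradSq_U_le (h : 0 < 4) {ε : ℝ} (hε : 0 < ε) (x : Euc 4) :
    gradSq (Ubub 4 h ε) x ≤ 32 * ε ^ 2 / DD ε x ^ 3 := by
  rw [gradSq_U h hε]
  have := DD_pos hε x
  calc 32 * ε ^ 2 * (DD ε x - ε ^ 2) / DD ε x ^ 4 ≤ 32 * ε ^ 2 * DD ε x / DD ε x ^ 4 := by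
        gcongr; nlinarith [sq_nonneg ε]
    _ = _ := by field_simp

lemma GG_nonneg {ε : ℝ} (hε : 0 < ε) (x : Euc 4) :
    0 ≤ ε / (‖x‖ + ε) ^ 5 ∧ 0 ≤ ww ‖x‖ ∧ 0 ≤ ((1 + ‖x‖) ^ 5)⁻¹ := by
  refine ⟨by positivity, ?_, by positivity⟩
  unfold ww; split_ifs <;> positivity

lemma pointwise_in (h : 0 < 4) {φ : Euc 4 → ℝ} (hφ : IsCutoff 4 φ) {ε : ℝ} (hε : 0 < ε) {x : Euc 4}
    (hx : 0 < x 3) (hr : ‖x‖ < 1) :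
    |Kw x * gradSq (Ut 4 h φ ε) x - gradSq (Ubub 4 h ε) x - 8 * ε ^ 2 * hh ε ‖x‖|
      ≤ 4800 * ε ^ 2 * GG ε x := by
  have h8 : √8 ^ 2 = 8 := Real.sq_sqrt (by norm_num)
  have hev : φ =ᶠ[𝓝 x] fun _ => (1:ℝ) := by
    filter_upwards [Metric.isOpen_ball.mem_nhds (show x ∈ Metric.ball (0 : Euc 4) 1 by simpa using hr)]
      with y hy
    exact hφ.eq_one y (Metric.ball_subset_closedBall hy)
  have hp : ∀ i, pd φ i x = 0 := by
    intro i; rw [pd, hev.fderiv_eq]; simp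
  have hφ1 : φ x = 1 := hev.eq_of_nhds
  have hc : ContDiff ℝ 1 φ := hφ.smooth.of_le (by exact_mod_cast le_top)
  have h0 := DD_pos hε x
  have hexp : Kw x * gradSq (Ut 4 h φ ε) x = gradSq (Ubub 4 h ε) x
      + 8 * ε ^ 2 * ((‖x‖ ^ 2 + √2 * ε * x 3) / DD ε x ^ 3)
      + ε ^ 2 / 2 * (‖x‖ ^ 2 / DD ε x ^ 2) := by
    have h1 : ‖x‖ ^ 2 / 16 * (Ubub 4 h ε x) ^ 2 = ε ^ 2 / 2 * (‖x‖ ^ 2 / DD ε x ^ 2) := by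
      rw [Ubub_eq]; simp only [div_pow, mul_pow, h8]; ring
    have h2 := cross_U h hε x
    rw [← h1, Kw_gradSq h hc hε, nsq]
    rw [nsq] at h2
    simp_rw [hp, hφ1, gradSq, Fin.sum_univ_four] at h2 ⊢
    linear_combination (-1/2 : ℝ) * h2
  have hxr : x 3 ≤ ‖x‖ := (le_abs_self _).trans (coord_le x 3)
  have hr0 : 0 < ‖x‖ := hx.trans_le hxr
  obtain ⟨g1, g2, g3⟩ := GG_nonneg hε x
  have hA : |(‖x‖ ^ 2 + √2 * ε * x 3) / DD ε x ^ 3 - hh ε ‖x‖| ≤ 600 * (ε / (‖x‖ + ε) ^ 5) := by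
    by_cases hre : ε < ‖x‖
    · rw [hh, if_pos ⟨hre, hr⟩]
      exact scalar_far hε hre hx hxr (Real.sqrt_nonneg _) sqrt2_le rfl
    · rw [hh, if_neg (by tauto), sub_zero]
      exact scalar_near hε hr0 (not_lt.1 hre) hx (Real.sqrt_nonneg _) rfl
  have hB : ‖x‖ ^ 2 / DD ε x ^ 2 ≤ ww ‖x‖ := by
    rw [ww, if_pos hr]
    have : ‖x‖ ^ 2 ≤ DD ε x := by nlinarith [DD_ge hε hx, sq_nonneg ε]
    calc ‖x‖ ^ 2 / DD ε x ^ 2 ≤ ‖x‖ ^ 2 / (‖x‖ ^ 2) ^ 2 := by gcongr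
      _ = _ := by field_simp
  have hB0 : 0 ≤ ‖x‖ ^ 2 / DD ε x ^ 2 := by positivity
  rw [hexp]
  generalize (‖x‖ ^ 2 + √2 * ε * x 3) / DD ε x ^ 3 = A at *
  generalize ‖x‖ ^ 2 / DD ε x ^ 2 = B at *
  have : gradSq (Ubub 4 h ε) x + 8 * ε ^ 2 * A + ε ^ 2 / 2 * B - gradSq (Ubub 4 h ε) x
      - 8 * ε ^ 2 * hh ε ‖x‖ = ε ^ 2 * (8 * (A - hh ε ‖x‖) + B / 2) := by ring
  rw [this, abs_mul, abs_of_nonneg (sq_nonneg ε), mul_comm 4800, mul_assoc]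
  gcongr
  rw [GG, abs_le]
  rw [abs_le] at hA
  constructor <;> linarith [hA.1, hA.2]

lemma pointwise_out (h : 0 < 4) {φ : Euc 4 → ℝ} (hφ : IsCutoff 4 φ) {M : ℝ} (hM0 : 0 ≤ M)
    (hM : ∀ x ∈ Metric.closedBall (0 : Euc 4) 2, ‖fderiv ℝ φ x‖ ≤ M)
    {ε : ℝ} (hε : 0 < ε) (hε1 : ε < 1) {x : Euc 4}
    (hx : 0 < x 3) (hr : 1 ≤ ‖x‖) :
    |Kw x * gradSq (Ut 4 h φ ε) x - gradSq (Ubub 4 h ε) x - 8 * ε ^ 2 * hh ε ‖x‖|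
      ≤ (4 * (23 + 3 * M) ^ 2 * 243 + 1024) * ε ^ 2 * GG ε x := by
  have hc : ContDiff ℝ 1 φ := hφ.smooth.of_le (by exact_mod_cast le_top)
  obtain ⟨g1, g2, g3⟩ := GG_nonneg hε x
  rw [hh, if_neg (by rintro ⟨_, _⟩; linarith), mul_zero, sub_zero]
  have hD : ‖x‖ ^ 2 ≤ DD ε x := by nlinarith [DD_ge hε hx, sq_nonneg ε]
  have hD1 : 1 ≤ DD ε x := by nlinarith
  have hU : gradSq (Ubub 4 h ε) x ≤ 1024 * ε ^ 2 * ((1 + ‖x‖) ^ 5)⁻¹ := by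
    refine (gradSq_U_le h hε x).trans ?_
    calc 32 * ε ^ 2 / DD ε x ^ 3 ≤ 32 * ε ^ 2 / (‖x‖ ^ 2) ^ 3 := by gcongr
      _ ≤ 32 * ε ^ 2 / ‖x‖ ^ 5 := by
          rw [← pow_mul]
          gcongr
          all_goals first | exact hr | norm_num
      _ = 32 * ε ^ 2 * 32 / (2 * ‖x‖) ^ 5 := by field_simp; norm_num
      _ ≤ 32 * ε ^ 2 * 32 / (1 + ‖x‖) ^ 5 := by gcongr; linarith
      _ = _ := by ring
  have hU0 := gradSq_U_nonneg h ε x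
  have hF0 : 0 ≤ Kw x * gradSq (Ut 4 h φ ε) x := by
    rw [Kw_gradSq h hc hε]; exact Finset.sum_nonneg (fun i _ => sq_nonneg _)
  have hF : Kw x * gradSq (Ut 4 h φ ε) x ≤ 4 * (23 + 3 * M) ^ 2 * 243 * ε ^ 2 * ((1 + ‖x‖) ^ 5)⁻¹ := by
    rw [Kw_gradSq h hc hε]
    by_cases hr2 : ‖x‖ ≤ 2
    · have hs8 : √8 ≤ 3 := by rw [Real.sqrt_le_left (by norm_num)]; norm_num
      have hUU : |Ubub 4 h ε x| ≤ 3 * ε := by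
        rw [Ubub_eq]; dsimp only
        rw [abs_of_nonneg (by have := DD_pos hε x; positivity), div_le_iff₀ (DD_pos hε x)]
        nlinarith [mul_le_mul_of_nonneg_left hs8 hε.le]
      have hpU : ∀ i, |pd (Ubub 4 h ε) i x| ≤ 21 * ε := by
        intro i
        have hd : |dD ε i x| ≤ 7 := by
          have h1 : |x i| ≤ 2 := (coord_le x i).trans hr2
          have h2 : 0 ≤ √2 * ε := by positivity
          have h3 : √2 * ε ≤ 3 / 2 := by
            nlinarith [sqrt2_le, Real.sqrt_nonneg 2]
          rw [abs_le] at h1 ⊢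
          rw [dD]; split_ifs <;> constructor <;> linarith [h1.1, h1.2]
        rw [pd_U h hε, abs_neg, abs_div, abs_mul, abs_of_nonneg (by positivity : 0 ≤ ε * √8),
          abs_of_nonneg (by positivity : 0 ≤ DD ε x ^ 2), div_le_iff₀ (by positivity)]
        have : 1 ≤ DD ε x ^ 2 := one_le_pow₀ hD1
        calc ε * √8 * |dD ε i x| ≤ ε * 3 * 7 := by gcongr
          _ = 21 * ε * 1 := by ring
          _ ≤ 21 * ε * DD ε x ^ 2 := by gcongr
      have hpφ : ∀ i, |pd φ i x| ≤ M := by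
        intro i
        have h1 := (fderiv ℝ φ x).le_opNorm (EuclideanSpace.single i (1:ℝ))
        rw [pd]
        have h2 := hM x (by simpa using hr2)
        simp at h1
        exact h1.trans h2
      have hφ1 : |φ x| ≤ 1 := by
        obtain ⟨a, b⟩ := hφ.mem01 x
        rw [abs_le]; constructor <;> linarith
      have hterm : ∀ i, (-(x i / 4) * φ x * Ubub 4 h ε x + pd φ i x * Ubub 4 h ε x
        + φ x * pd (Ubub 4 h ε) i x) ^ 2 ≤ ((23 + 3 * M) * ε) ^ 2 := by
        intro i
        apply sq_le_sq'
        all_goals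
          have a1 : |-(x i / 4) * φ x * Ubub 4 h ε x| ≤ (2/4) * 1 * (3 * ε) := by
            rw [abs_mul, abs_mul, abs_neg, abs_div, abs_of_pos (by norm_num : (0:ℝ) < 4)]
            gcongr
            exact (coord_le x i).trans hr2
          have a2 : |pd φ i x * Ubub 4 h ε x| ≤ M * (3 * ε) := by
            rw [abs_mul]; gcongr; exact hpφ i
          have a3 : |φ x * pd (Ubub 4 h ε) i x| ≤ 1 * (21 * ε) := by
            rw [abs_mul]; gcongr; exact hpU i
          rw [abs_le] at a1 a2 a3
          nlinarith [a1.1, a1.2, a2.1, a2.2, a3.1, a3.2]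
      have hpow : 1 ≤ 243 * ((1 + ‖x‖) ^ 5)⁻¹ := by
        rw [← div_eq_mul_inv, le_div_iff₀ (by positivity)]
        calc 1 * (1 + ‖x‖) ^ 5 ≤ 1 * (1 + 2) ^ 5 := by gcongr
          _ = 243 := by norm_num
      calc _ ≤ ∑ i : Fin 4, ((23 + 3 * M) * ε) ^ 2 := Finset.sum_le_sum (fun i _ => hterm i)
        _ = (4 * (23 + 3 * M) ^ 2 * ε ^ 2) * 1 := by simp; ring
        _ ≤ (4 * (23 + 3 * M) ^ 2 * ε ^ 2) * (243 * ((1 + ‖x‖) ^ 5)⁻¹) := by gcongr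
        _ = _ := by ring
    · push Not at hr2
      have hev : φ =ᶠ[𝓝 x] fun _ => (0:ℝ) := by
        filter_upwards [Metric.isClosed_closedBall.isOpen_compl.mem_nhds
          (show x ∈ (Metric.closedBall (0 : Euc 4) 2)ᶜ by simpa using hr2)] with y hy
        exact hφ.eq_zero y (fun hy' => hy (Metric.ball_subset_closedBall hy'))
      have hp : ∀ i, pd φ i x = 0 := by
        intro i; rw [pd, hev.fderiv_eq]; simp
      have hφ1 : φ x = 0 := hev.eq_of_nhds
      simp only [hp, hφ1]
      simp
      positivity
  have e2 : 0 ≤ ε ^ 2 := sq_nonneg ε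
  have hGG : ((1 + ‖x‖) ^ 5)⁻¹ ≤ GG ε x := by rw [GG]; linarith
  have hb : (4 * (23 + 3 * M) ^ 2 * 243 + 1024) * ε ^ 2 * ((1 + ‖x‖) ^ 5)⁻¹
    ≤ (4 * (23 + 3 * M) ^ 2 * 243 + 1024) * ε ^ 2 * GG ε x := by gcongr
  refine le_trans ?_ hb
  have p1 : 0 ≤ 4 * (23 + 3 * M) ^ 2 * 243 * ε ^ 2 * ((1 + ‖x‖) ^ 5)⁻¹ := by positivity
  rw [abs_le]
  constructor <;> nlinarith

lemma pointwise (h : 0 < 4) {φ : Euc 4 → ℝ} (hφ : IsCutoff 4 φ) :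
    ∃ C : ℝ, 0 < C ∧ ∀ ε : ℝ, 0 < ε → ε < 1 → ∀ x : Euc 4, 0 < x 3 →
    |Kw x * gradSq (Ut 4 h φ ε) x - gradSq (Ubub 4 h ε) x - 8 * ε ^ 2 * hh ε ‖x‖|
      ≤ C * ε ^ 2 * GG ε x := by
  have hc : ContDiff ℝ 1 φ := hφ.smooth.of_le (by exact_mod_cast le_top)
  obtain ⟨M, hM⟩ := (isCompact_closedBall (0 : Euc 4) 2).exists_bound_of_continuousOn
    (hc.continuous_fderiv one_ne_zero).continuousOn
  have hM0 : 0 ≤ M := (norm_nonneg _).trans (hM 0 (by simp))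
  refine ⟨4800 + (4 * (23 + 3 * M) ^ 2 * 243 + 1024), by positivity, ?_⟩
  intro ε hε hε1 x hx
  obtain ⟨g1, g2, g3⟩ := GG_nonneg hε x
  have hG : 0 ≤ GG ε x := by rw [GG]; positivity
  rcases lt_or_ge ‖x‖ 1 with hr | hr
  · refine (pointwise_in h hφ hε hx hr).trans ?_
    exact mul_le_mul_of_nonneg_right (mul_le_mul_of_nonneg_right
      (by nlinarith [sq_nonneg (23 + 3 * M)]) (sq_nonneg ε)) hG
  · refine (pointwise_out h hφ hM0 hM hε hε1 hx hr).trans ?_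
    exact mul_le_mul_of_nonneg_right (mul_le_mul_of_nonneg_right
      (by linarith) (sq_nonneg ε)) hG

lemma fr4 : Module.finrank ℝ (Euc 4) = 4 := by simp

lemma int5 : Integrable (fun x : Euc 4 => ((1 + ‖x‖) ^ 5)⁻¹) := by
  have h := integrable_one_add_norm (E := Euc 4) (μ := volume) (r := 5) (by rw [fr4]; norm_num)
  refine h.congr (Eventually.of_forall fun x => ?_)
  dsimp only
  rw [Real.rpow_neg (by positivity)]
  norm_cast

lemma resc {ε : ℝ} (hε : 0 < ε) : (fun x : Euc 4 => ε / (‖x‖ + ε) ^ 5)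
    = fun x => (ε ^ 4)⁻¹ * (fun x : Euc 4 => ((1 + ‖x‖) ^ 5)⁻¹) (ε⁻¹ • x) := by
  funext x
  simp only [norm_smul, norm_inv, Real.norm_eq_abs, abs_of_pos hε]
  have : 1 + ε⁻¹ * ‖x‖ = (‖x‖ + ε) / ε := by field_simp; ring
  rw [this]
  have : 0 < ‖x‖ + ε := by positivity
  field_simp

lemma int_resc {ε : ℝ} (hε : 0 < ε) : Integrable (fun x : Euc 4 => ε / (‖x‖ + ε) ^ 5) := by
  rw [resc hε]
  exact ((integrable_comp_smul_iff volume _ (inv_ne_zero hε.ne')).2 int5).const_mul _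

lemma integral_resc {ε : ℝ} (hε : 0 < ε) :
    ∫ x : Euc 4, ε / (‖x‖ + ε) ^ 5 = ∫ x : Euc 4, ((1 + ‖x‖) ^ 5)⁻¹ := by
  rw [resc hε, integral_const_mul, Measure.integral_comp_inv_smul_of_nonneg volume
    (fun x : Euc 4 => ((1 + ‖x‖) ^ 5)⁻¹) hε.le, fr4, smul_eq_mul, inv_mul_cancel_left₀ (by positivity)]

lemma int_ww : Integrable (fun x : Euc 4 => ww ‖x‖) := by
  rw [integrable_fun_norm_addHaar volume (f := ww), fr4]
  have : IntegrableOn (fun y : ℝ => (Set.Ioc (0:ℝ) 1).indicator (fun _ => (1:ℝ)) y) (Set.Ioi 0) := by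
    refine Integrable.integrableOn ?_
    rw [integrable_indicator_iff measurableSet_Ioc]
    exact integrableOn_const (by simp)
  refine Integrable.mono' this ?_ ?_
  · apply Measurable.aestronglyMeasurable
    unfold ww
    exact (measurable_id.pow_const _).smul
      (Measurable.ite measurableSet_Iio (by fun_prop) measurable_const)
  · filter_upwards [ae_restrict_mem measurableSet_Ioi] with y hy
    have hy : 0 < y := hy
    unfold ww
    split_ifs with h1
    · rw [Set.indicator_of_mem (show y ∈ Set.Ioc (0:ℝ) 1 from ⟨hy, h1.le⟩), smul_eq_mul, Real.norm_eq_abs,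
        abs_of_nonneg (by positivity)]
      have : y ^ (4 - 1) * (y ^ 2)⁻¹ = y := by field_simp
      rw [this]; exact h1.le
    · rw [smul_zero, norm_zero]
      exact Set.indicator_nonneg (fun _ _ => zero_le_one) _

lemma int_GG {ε : ℝ} (hε : 0 < ε) : Integrable (GG ε) :=
  ((int_resc hε).add int_ww).add int5

lemma integral_GG {ε : ℝ} (hε : 0 < ε) :
    ∫ x, GG ε x = (∫ x : Euc 4, ((1 + ‖x‖) ^ 5)⁻¹) + (∫ x : Euc 4, ww ‖x‖)
      + ∫ x : Euc 4, ((1 + ‖x‖) ^ 5)⁻¹ := by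
  have h1 := integral_add ((int_resc hε).add int_ww) int5
  have h2 := integral_add (int_resc hε) int_ww
  rw [integral_resc hε] at h2
  rw [← h2]
  exact h1

lemma hh_meas (ε : ℝ) : Measurable (hh ε) := by
  unfold hh
  exact Measurable.ite (measurableSet_Ioi.inter measurableSet_Iio) (by fun_prop) measurable_const

lemma hh_cube {ε : ℝ} (hε : 0 < ε) (y : ℝ) :
    y ^ (4 - 1) • hh ε y = (Set.Ioo ε 1).indicator (fun y => y⁻¹) y := by
  unfold hh
  split_ifs with h
  · rw [Set.indicator_of_mem (show y ∈ Set.Ioo ε 1 from h)]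
    have : 0 < y := hε.trans h.1
    simp only [smul_eq_mul]
    field_simp
  · rw [Set.indicator_of_notMem (show y ∉ Set.Ioo ε 1 from h), smul_zero]

lemma int_inv {ε : ℝ} (hε : 0 < ε) : IntegrableOn (fun y : ℝ => y⁻¹) (Set.Ioo ε 1) := by
  refine (ContinuousOn.integrableOn_Icc (a := ε) (b := 1) ?_).mono_set Set.Ioo_subset_Icc_self
  exact continuousOn_inv₀.mono (fun y hy => (hε.trans_le hy.1).ne')

lemma int_hh {ε : ℝ} (hε : 0 < ε) : Integrable (fun x : Euc 4 => hh ε ‖x‖) := by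
  rw [integrable_fun_norm_addHaar volume (f := hh ε), fr4]
  simp_rw [hh_cube hε]
  refine Integrable.integrableOn ?_
  rw [integrable_indicator_iff measurableSet_Ioo]
  exact int_inv hε

lemma integral_hh {ε : ℝ} (hε : 0 < ε) (hε1 : ε < 1) :
    ∫ x : Euc 4, hh ε ‖x‖ = 2 * π ^ 2 * (-Real.log ε) := by
  rw [integral_fun_norm_addHaar volume (hh ε), fr4]
  simp_rw [hh_cube hε]
  rw [setIntegral_indicator measurableSet_Ioo,
    Set.inter_eq_self_of_subset_right (show Set.Ioo ε 1 ⊆ Set.Ioi 0 from fun y hy => hε.trans hy.1), ← integral_Ioc_eq_integral_Ioo,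
    ← intervalIntegral.integral_of_le hε1.le, integral_inv_of_pos hε one_pos, Measure.real,
    InnerProductSpace.volume_ball_of_dim_even (k := 2) (by simp)]
  rw [one_div, Real.log_inv]
  simp [Nat.factorial]
  rw [ENNReal.toReal_ofReal (by positivity)]
  ring

lemma mem_HH (x : Euc 4) : x ∈ HH ↔ 0 < x 3 := Iff.rfl

lemma meas_HH : MeasurableSet HH := by
  have : HH = p3 ⁻¹' (Set.Ioi 0) := rfl
  rw [this]
  exact p3.continuous.measurable measurableSet_Ioi

lemma hyper_null : (volume : Measure (Euc 4)) {x | x 3 = 0} = 0 := by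
  have : {x : Euc 4 | x 3 = 0} = (LinearMap.ker (p3 : Euc 4 →ₗ[ℝ] ℝ) : Set (Euc 4)) := by
    ext x; simp [p3]
  rw [this]
  apply Measure.addHaar_submodule
  intro h
  have : (EuclideanSpace.single (3 : Fin 4) (1:ℝ) : Euc 4) ∈ LinearMap.ker (p3 : Euc 4 →ₗ[ℝ] ℝ) := by
    rw [h]; trivial
  simp [p3] at this

lemma half {f : ℝ → ℝ} (hf : Integrable (fun x : Euc 4 => f ‖x‖)) :
    ∫ x in HH, f ‖x‖ = (1 / 2) * ∫ x : Euc 4, f ‖x‖ := by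
  have h1 := integral_add_compl meas_HH hf
  have h2 : ∫ x in HHᶜ, f ‖x‖ = ∫ x in HH, f ‖x‖ := by
    rw [← integral_indicator meas_HH.compl, ← integral_indicator meas_HH,
      ← integral_neg_eq_self (HH.indicator _)]
    apply integral_congr_ae
    have : ∀ᵐ x : Euc 4, x 3 ≠ 0 := by
      rw [ae_iff]; simpa using hyper_null
    filter_upwards [this] with x hx
    by_cases h : 0 < x 3
    · rw [Set.indicator_of_notMem (by rw [Set.mem_compl_iff, mem_HH]; simpa using h),
        Set.indicator_of_notMem (by rw [mem_HH]; simpa using h.le)]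
    · have h' : x 3 < 0 := lt_of_le_of_ne (not_lt.1 h) hx
      rw [Set.indicator_of_mem (by rw [Set.mem_compl_iff, mem_HH]; exact h),
        Set.indicator_of_mem (by rw [mem_HH]; simpa using h'), norm_neg]
  linarith

lemma cont_gradSq {u : Euc 4 → ℝ} (hu : ContDiff ℝ 1 u) : Continuous (gradSq u) := by
  unfold gradSq pd
  have := hu.continuous_fderiv one_ne_zero
  fun_prop

lemma gradSq_scale (h : 0 < 4) {ε : ℝ} (hε : 0 < ε) (x : Euc 4) :
    gradSq (Ubub 4 h ε) x = (ε ^ 4)⁻¹ * gradSq (Ubub 4 h 1) (ε⁻¹ • x) := by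
  rw [gradSq_U h hε, gradSq_U h one_pos]
  have hD : DD 1 (ε⁻¹ • x) = DD ε x / ε ^ 2 := by
    simp only [DD, norm_smul, norm_inv, Real.norm_eq_abs, abs_of_pos hε, PiLp.smul_apply, smul_eq_mul]
    field_simp
  rw [hD]
  have := DD_pos hε x
  field_simp

lemma int_U1 (h : 0 < 4) : IntegrableOn (gradSq (Ubub 4 h 1)) HH := by
  refine Integrable.mono' ((int5.const_mul (1024)).integrableOn (s := HH))
    (cont_gradSq (contDiff_U h one_pos)).aestronglyMeasurable ?_
  filter_upwards [ae_restrict_mem meas_HH] with x hx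
  rw [Real.norm_eq_abs, abs_of_nonneg (gradSq_U_nonneg h 1 x)]
  refine (gradSq_U_le h one_pos x).trans ?_
  have hD := DD_ge one_pos hx
  have hD2 : (1 + ‖x‖) ^ 2 / 2 ≤ DD 1 x := by nlinarith [sq_nonneg (‖x‖ - 1)]
  have h1 : (1:ℝ) ≤ 1 + ‖x‖ := by linarith [norm_nonneg x]
  calc 32 * 1 ^ 2 / DD 1 x ^ 3 ≤ 32 * 1 ^ 2 / ((1 + ‖x‖) ^ 2 / 2) ^ 3 := by gcongr
    _ = 256 * ((1 + ‖x‖) ^ 6)⁻¹ := by field_simp; norm_num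
    _ ≤ 1024 * ((1 + ‖x‖) ^ 5)⁻¹ := by
        gcongr
        all_goals first | exact h1 | norm_num

lemma HH_smul {ε : ℝ} (hε : 0 < ε) (x : Euc 4) : ε⁻¹ • x ∈ HH ↔ x ∈ HH := by
  rw [mem_HH, mem_HH, PiLp.smul_apply, smul_eq_mul, mul_pos_iff_of_pos_left (inv_pos.2 hε)]

lemma ind_scale (h : 0 < 4) {ε : ℝ} (hε : 0 < ε) :
    HH.indicator (gradSq (Ubub 4 h ε))
      = fun x => (ε ^ 4)⁻¹ * (HH.indicator (gradSq (Ubub 4 h 1))) (ε⁻¹ • x) := by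
  funext x
  by_cases hx : x ∈ HH
  · rw [Set.indicator_of_mem hx, Set.indicator_of_mem ((HH_smul hε x).2 hx), gradSq_scale h hε]
  · rw [Set.indicator_of_notMem hx, Set.indicator_of_notMem (fun h' => hx ((HH_smul hε x).1 h')),
      mul_zero]

lemma int_Ueps (h : 0 < 4) {ε : ℝ} (hε : 0 < ε) : IntegrableOn (gradSq (Ubub 4 h ε)) HH := by
  rw [← integrable_indicator_iff meas_HH, ind_scale h hε]
  exact ((integrable_comp_smul_iff volume _ (inv_ne_zero hε.ne')).2
    ((integrable_indicator_iff meas_HH).2 (int_U1 h))).const_mul _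

lemma integral_Ueps (h : 0 < 4) {ε : ℝ} (hε : 0 < ε) :
    ∫ x in HH, gradSq (Ubub 4 h ε) x = Kone 4 h := by
  have : Kone 4 h = ∫ x in HH, gradSq (Ubub 4 h 1) x := rfl
  rw [this, ← integral_indicator meas_HH, ← integral_indicator meas_HH, ind_scale h hε,
    integral_const_mul, Measure.integral_comp_inv_smul_of_nonneg _ _ hε.le, fr4,
    smul_eq_mul, inv_mul_cancel_left₀ (by positivity)]

lemma int_F (h : 0 < 4) {φ : Euc 4 → ℝ} (hφ : IsCutoff 4 φ) {ε : ℝ} (hε : 0 < ε) :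
    Integrable (fun x => Kw x * gradSq (Ut 4 h φ ε) x) := by
  have hc : ContDiff ℝ 1 φ := hφ.smooth.of_le (by exact_mod_cast le_top)
  have hut : ContDiff ℝ 1 (Ut 4 h φ ε) := by
    rw [Ut_eq]
    exact (((contDiff_const.mul (contDiff_norm_sq ℝ)).exp).mul hc).mul (contDiff_U h hε)
  have hK : Continuous (Kw (N := 4)) := by unfold Kw; fun_prop
  refine (hK.mul (cont_gradSq hut)).integrable_of_hasCompactSupport ?_
  refine HasCompactSupport.intro (isCompact_closedBall (0 : Euc 4) 2) ?_
  intro x hx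
  have hev : φ =ᶠ[𝓝 x] fun _ => (0:ℝ) := by
    filter_upwards [Metric.isClosed_closedBall.isOpen_compl.mem_nhds hx] with y hy
    exact hφ.eq_zero y (fun hy' => hy (Metric.ball_subset_closedBall hy'))
  have hp : ∀ i, pd φ i x = 0 := by
    intro i; rw [pd, hev.fderiv_eq]; simp
  have hφ1 : φ x = 0 := hev.eq_of_nhds
  rw [Pi.mul_apply, Kw_gradSq h hc hε]
  simp [hp, hφ1]

/-- Lemma 3.1, `N = 4`:
`∫ K|∇Ũ_ε|² = K₁ + (k₄²ω₄/2) ε²|log ε| + O(ε²) = K₁ + 8π² ε²|log ε| + O(ε²)`. -/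
theorem statement14 (φ : Euc 4 → ℝ) (hφ : IsCutoff 4 φ) :
    ∃ C ε₀ : ℝ, 0 < C ∧ 0 < ε₀ ∧ ∀ ε : ℝ, 0 < ε → ε < ε₀ →
      abs ((∫ x in upperHS 4 (by norm_num : 0 < 4),
            Kw x * gradSq (Ut 4 (by norm_num) φ ε) x)
          - Kone 4 (by norm_num)
          - 8 * Real.pi ^ 2 * ε ^ 2 * abs (Real.log ε)) ≤ C * ε ^ 2 := by
  have h4 : 0 < 4 := by norm_num
  obtain ⟨C, hC, hpt⟩ := pointwise h4 hφ
  obtain ⟨B, hB⟩ : ∃ B : ℝ, B = (∫ x : Euc 4, ((1 + ‖x‖) ^ 5)⁻¹) + (∫ x : Euc 4, ww ‖x‖)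
      + ∫ x : Euc 4, ((1 + ‖x‖) ^ 5)⁻¹ := ⟨_, rfl⟩
  have hB0 : 0 ≤ B := by
    rw [hB, ← integral_GG one_pos]
    refine integral_nonneg (fun x => ?_)
    obtain ⟨g1, g2, g3⟩ := GG_nonneg one_pos x
    rw [GG]; positivity
  refine ⟨C * B + 1, 1, by positivity, one_pos, ?_⟩
  intro ε hε hε1
  have i1 := (int_F h4 hφ hε).integrableOn (s := HH)
  have i2 := int_Ueps h4 hε
  have i3 := ((int_hh hε).const_mul (8 * ε ^ 2)).integrableOn (s := HH)
  have key : ‖∫ x in HH, (Kw x * gradSq (Ut 4 h4 φ ε) x - gradSq (Ubub 4 h4 ε) x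
      - 8 * ε ^ 2 * hh ε ‖x‖)‖ ≤ ∫ x in HH, C * ε ^ 2 * GG ε x := by
    refine norm_integral_le_of_norm_le ((int_GG hε).const_mul _).integrableOn ?_
    filter_upwards [ae_restrict_mem meas_HH] with x hx
    exact hpt ε hε hε1 x hx
  have hle : ∫ x in HH, C * ε ^ 2 * GG ε x ≤ C * ε ^ 2 * B := by
    rw [integral_const_mul, hB, ← integral_GG hε]
    refine mul_le_mul_of_nonneg_left ?_ (by positivity)
    refine setIntegral_le_integral (int_GG hε) (Eventually.of_forall fun x => ?_)
    obtain ⟨g1, g2, g3⟩ := GG_nonneg hε x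
    simp only [GG, Pi.zero_apply]; positivity
  have hint : ∫ x in HH, (Kw x * gradSq (Ut 4 h4 φ ε) x - gradSq (Ubub 4 h4 ε) x
      - 8 * ε ^ 2 * hh ε ‖x‖) = (∫ x in HH, Kw x * gradSq (Ut 4 h4 φ ε) x) - Kone 4 h4
        - 8 * ε ^ 2 * ((1 / 2) * (2 * π ^ 2 * (-Real.log ε))) := by
    rw [← integral_hh hε hε1, ← half (int_hh hε), ← integral_Ueps h4 hε, ← integral_const_mul,
      ← integral_sub i1 i2]
    exact integral_sub (i1.sub i2) i3
  rw [hint] at key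
  have habs : |Real.log ε| = -Real.log ε := abs_of_neg (Real.log_neg hε hε1)
  rw [habs]
  have e : 8 * π ^ 2 * ε ^ 2 * (-Real.log ε)
      = 8 * ε ^ 2 * ((1 / 2) * (2 * π ^ 2 * (-Real.log ε))) := by ring
  rw [e]
  refine (key.trans hle).trans ?_
  nlinarith [sq_nonneg ε]
end
end

section
/- Let N ≥ 4. As ε → 0⁺, ∫_{ℝ^{N-1}} K(x',0) Ũ_ε(x',0)^{2_*} dx' = K₃ - γ_N ε² + o(ε²), where γ_N := (k_N^{2_*} / (4(N-2))) ∫_{ℝ^{N-1}} |y'|² / (1 + |y'|² + (x_N⁰)²)^{N-1} dy'. -/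
open MeasureTheory Real Topology Filter

noncomputable section

theorem emb_last (N : ℕ) (h : 0 < N) (y : Euc (N - 1)) : emb N y (lastIdx N h) = 0 := by
  simp [emb, lastIdx]

theorem horizSq_emb (N : ℕ) (h : 0 < N) (y : Euc (N - 1)) :
    horizSq h (emb N y) = ‖y‖ ^ 2 := by
  obtain ⟨m, rfl⟩ : ∃ m, N = m + 1 := ⟨N - 1, by omega⟩
  have h1 : horizSq h (emb (m+1) y) = ∑ i, (emb (m+1) y i) ^ 2 := by
    unfold horizSq
    rw [← Finset.add_sum_erase Finset.univ _ (Finset.mem_univ (lastIdx (m+1) h))]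
    rw [emb_last]; simp
  rw [h1, EuclideanSpace.real_norm_sq_eq, Fin.sum_univ_castSucc]
  have h2 : emb (m+1) y (Fin.last m) = 0 := emb_last (m+1) h y
  rw [h2]
  simp [emb]

theorem norm_emb (N : ℕ) (h : 0 < N) (y : Euc (N - 1)) : ‖emb N y‖ = ‖y‖ := by
  have h1 : ‖emb N y‖ ^ 2 = ‖y‖ ^ 2 := by
    rw [← horizSq_emb N h y, EuclideanSpace.real_norm_sq_eq]
    unfold horizSq
    rw [← Finset.add_sum_erase Finset.univ _ (Finset.mem_univ (lastIdx N h))]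
    rw [emb_last]; simp
  exact (pow_left_inj₀ (norm_nonneg _) (norm_nonneg _) two_ne_zero).1 h1

theorem continuous_emb (N : ℕ) : Continuous (emb N) := by
  unfold emb
  apply (EuclideanSpace.equiv (Fin N) ℝ).symm.continuous.comp
  apply continuous_pi
  intro i
  split_ifs
  · fun_prop
  · fun_prop

theorem Ubub_pow (N : ℕ) (hN : 4 ≤ N) (h : 0 < N) (ε : ℝ) (hε : 0 < ε) (y : Euc (N - 1)) :
    (Ubub N h ε (emb N y)) ^ twoStarL N =
      (ε * Real.sqrt ((N : ℝ) * ((N : ℝ) - 2)) /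
        (ε ^ 2 + ‖y‖ ^ 2 + (ε * xN0 N) ^ 2)) ^ (N - 1) := by
  have hN' : (4:ℝ) ≤ N := by exact_mod_cast hN
  unfold Ubub bubbleT
  rw [horizSq_emb, emb_last, ← Real.rpow_mul (by positivity)]
  rw [show ((N : ℝ) - 2) / 2 * twoStarL N = ((N - 1 : ℕ) : ℝ) by
    unfold twoStarL
    rw [Nat.cast_sub (by omega)]
    have : (N:ℝ) - 2 ≠ 0 := by linarith
    field_simp
    simp]
  rw [Real.rpow_natCast]
  simp

theorem kN_pow (N : ℕ) (hN : 4 ≤ N) :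
    kN N ^ twoStarL N = (Real.sqrt ((N : ℝ) * ((N : ℝ) - 2))) ^ (N - 1) := by
  have hN' : (4:ℝ) ≤ N := by exact_mod_cast hN
  have h2 : (N:ℝ) - 2 ≠ 0 := by linarith
  have h0 : 0 ≤ (N : ℝ) * ((N : ℝ) - 2) := mul_nonneg (by linarith) (by linarith)
  unfold kN
  rw [← Real.rpow_mul h0, Real.sqrt_eq_rpow, ← Real.rpow_natCast, ← Real.rpow_mul h0]
  congr 1
  unfold twoStarL
  rw [Nat.cast_sub (by omega)]
  push_cast
  field_simp
  norm_num

theorem Kw_Ut (N : ℕ) (hN : 4 ≤ N) (h : 0 < N) (φ : Euc N → ℝ) (hφ : IsCutoff N φ)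
    (ε : ℝ) (hε : 0 < ε) (y : Euc (N - 1)) :
    Kw (emb N y) * (Ut N h φ ε (emb N y)) ^ twoStarL N =
      Real.exp (-(1 / (4 * ((N : ℝ) - 2))) * ‖y‖ ^ 2) * φ (emb N y) ^ twoStarL N *
      (ε * Real.sqrt ((N : ℝ) * ((N : ℝ) - 2)) /
        (ε ^ 2 + ‖y‖ ^ 2 + (ε * xN0 N) ^ 2)) ^ (N - 1) := by
  have hN' : (4:ℝ) ≤ N := by exact_mod_cast hN
  have h2 : (N:ℝ) - 2 ≠ 0 := by linarith
  have hφ0 := (hφ.mem01 (emb N y)).1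
  have hU : 0 ≤ Ubub N h ε (emb N y) := by
    unfold Ubub bubbleT
    rw [horizSq_emb]
    positivity
  unfold Ut
  rw [Real.mul_rpow (mul_nonneg (by unfold Kw; positivity) hφ0) hU,
    Real.mul_rpow (by unfold Kw; positivity) hφ0, Ubub_pow N hN h ε hε]
  have : Kw (emb N y) * (Kw (emb N y) ^ (-(1 : ℝ) / 2)) ^ twoStarL N =
      Real.exp (-(1 / (4 * ((N : ℝ) - 2))) * ‖y‖ ^ 2) := by
    unfold Kw
    rw [norm_emb N h, ← Real.exp_mul, ← Real.exp_mul, ← Real.exp_add]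
    congr 1
    unfold twoStarL
    field_simp
    ring
  rw [← this]
  ring

theorem integral_scaled (N : ℕ) (hN : 4 ≤ N) (h : 0 < N) (φ : Euc N → ℝ) (hφ : IsCutoff N φ)
    (ε : ℝ) (hε : 0 < ε) :
    ∫ y : Euc (N - 1), Kw (emb N y) * (Ut N h φ ε (emb N y)) ^ twoStarL N =
    ∫ y : Euc (N - 1),
      Real.exp (-(1 / (4 * ((N : ℝ) - 2))) * (ε ^ 2 * ‖y‖ ^ 2)) *
        φ (emb N (ε • y)) ^ twoStarL N *
      (Real.sqrt ((N : ℝ) * ((N : ℝ) - 2)) ^ (N - 1) /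
        (1 + ‖y‖ ^ 2 + (xN0 N) ^ 2) ^ (N - 1)) := by
  have key := Measure.integral_comp_smul (volume : Measure (Euc (N-1)))
    (fun y => Kw (emb N y) * (Ut N h φ ε (emb N y)) ^ twoStarL N) ε
  rw [finrank_euclideanSpace, Fintype.card_fin, abs_of_pos (by positivity), smul_eq_mul] at key
  have h1 : ∫ y : Euc (N - 1), Kw (emb N y) * (Ut N h φ ε (emb N y)) ^ twoStarL N =
      ε ^ (N - 1) * ∫ y : Euc (N - 1),
        Kw (emb N (ε • y)) * (Ut N h φ ε (emb N (ε • y))) ^ twoStarL N := by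
    rw [key]; field_simp
  rw [h1, ← integral_const_mul]
  congr 1
  funext y
  rw [Kw_Ut N hN h φ hφ ε hε, norm_smul, Real.norm_of_nonneg hε.le, mul_pow]
  rw [← div_pow, mul_left_comm, ← mul_pow]
  have hdiv : ε * (ε * Real.sqrt ((N : ℝ) * ((N : ℝ) - 2)) /
        (ε ^ 2 + ε ^ 2 * ‖y‖ ^ 2 + ε ^ 2 * xN0 N ^ 2)) =
      Real.sqrt ((N : ℝ) * ((N : ℝ) - 2)) / (1 + ‖y‖ ^ 2 + xN0 N ^ 2) := by
    field_simp
  rw [← hdiv, mul_pow ε (xN0 N), mul_pow ε ‖y‖, mul_pow ε (_ / _)]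

theorem integrable_main (N : ℕ) (hN : 4 ≤ N) (a : ℝ) :
    Integrable (fun y : Euc (N - 1) => (1 + ‖y‖ ^ 2) / (1 + ‖y‖ ^ 2 + a ^ 2) ^ (N - 1)) := by
  have hi : Integrable (fun y : Euc (N - 1) => (1 + ‖y‖ ^ 2) ^ (-(2 * ((N:ℝ) - 2)) / 2)) := by
    apply integrable_rpow_neg_one_add_norm_sq
    rw [finrank_euclideanSpace, Fintype.card_fin, Nat.cast_sub (by omega)]
    have hN' : (4:ℝ) ≤ N := by exact_mod_cast hN
    push_cast
    linarith
  refine hi.mono' ?_ (Eventually.of_forall fun y => ?_)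
  · apply Continuous.aestronglyMeasurable
    apply Continuous.div (by fun_prop) (by fun_prop)
    intro y
    positivity
  · rw [Real.norm_of_nonneg (by positivity)]
    rw [show -(2 * ((N:ℝ) - 2)) / 2 = -((N - 2 : ℕ) : ℝ) by
      rw [Nat.cast_sub (by omega)]; push_cast; ring]
    rw [Real.rpow_neg (by positivity), Real.rpow_natCast]
    rw [div_le_iff₀ (by positivity)]
    calc 1 + ‖y‖ ^ 2 = ((1 + ‖y‖ ^ 2) ^ (N - 2))⁻¹ * (1 + ‖y‖ ^ 2) ^ (N - 1) := by
          have hpw : ∀ t : ℝ, t ^ (N - 1) = t ^ (N - 2) * t := fun t => by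
            rw [show N - 1 = N - 2 + 1 by omega, pow_succ]
          rw [hpw]; field_simp
      _ ≤ _ := by
          have hle : 1 + ‖y‖ ^ 2 ≤ 1 + ‖y‖ ^ 2 + a ^ 2 := by nlinarith [sq_nonneg a]
          exact mul_le_mul_of_nonneg_left (pow_le_pow_left₀ (by positivity) hle _)
            (by positivity)

/-- Lemma 3.4, `N ≥ 4`:
`∫_{ℝ^{N-1}} K Ũ_ε^{2_*} = K₃ - γ_N ε² + o(ε²)` as `ε → 0⁺`. -/
theorem statement16 (N : ℕ) (hN : 4 ≤ N) (φ : Euc N → ℝ) (hφ : IsCutoff N φ) :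
    Tendsto (fun ε : ℝ =>
        ((∫ y : Euc (N - 1),
              Kw (emb N y) * (Ut N (by omega) φ ε (emb N y)) ^ twoStarL N)
            - Kthree N (by omega)
            + ((kN N ^ twoStarL N / (4 * ((N : ℝ) - 2))) *
                ∫ y : Euc (N - 1),
                  ‖y‖ ^ 2 / (1 + ‖y‖ ^ 2 + (xN0 N) ^ 2) ^ (N - 1)) * ε ^ 2)
          / ε ^ 2)
      (𝓝[>] (0 : ℝ)) (𝓝 0) := by
  have hN' : (4:ℝ) ≤ N := by exact_mod_cast hN
  have h0 : 0 < N := by omega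
  obtain ⟨c, hc⟩ : ∃ c, c = 1 / (4 * ((N : ℝ) - 2)) := ⟨_, rfl⟩
  have hcpos : 0 < c := by
    rw [hc]
    have : 0 < (N:ℝ) - 2 := by linarith
    positivity
  have hp : 0 ≤ twoStarL N := by
    unfold twoStarL
    exact div_nonneg (by linarith) (by linarith)
  obtain ⟨A, hA⟩ : ∃ A, A = Real.sqrt ((N : ℝ) * ((N : ℝ) - 2)) ^ (N - 1) := ⟨_, rfl⟩
  have hApos : 0 ≤ A := by rw [hA]; positivity
  let D : Euc (N - 1) → ℝ := fun y => (1 + ‖y‖ ^ 2 + (xN0 N) ^ 2) ^ (N - 1)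
  have hD : ∀ y, 0 < D y := fun y => by positivity
  have hDc : Continuous D := by fun_prop
  let E : ℝ → Euc (N - 1) → ℝ := fun ε y =>
    Real.exp (-c * (ε ^ 2 * ‖y‖ ^ 2)) * φ (emb N (ε • y)) ^ twoStarL N
  have hφc : Continuous φ := hφ.smooth.continuous
  have hEc : ∀ ε, Continuous (E ε) := fun ε => by
    have h1 : Continuous fun y : Euc (N-1) => φ (emb N (ε • y)) :=
      hφc.comp ((continuous_emb N).comp (continuous_const_smul ε))
    exact (by fun_prop : Continuous fun y : Euc (N-1) => Real.exp (-c * (ε ^ 2 * ‖y‖ ^ 2))).mul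
      (h1.rpow_const fun _ => Or.inr hp)
  have hE0 : ∀ ε y, 0 ≤ E ε y := fun ε y =>
    mul_nonneg (Real.exp_pos _).le (Real.rpow_nonneg (hφ.mem01 _).1 _)
  have hE1 : ∀ ε y, E ε y ≤ 1 := fun ε y =>
    mul_le_one₀ (Real.exp_le_one_iff.2 (by
      have : 0 ≤ c * (ε ^ 2 * ‖y‖ ^ 2) := by positivity
      linarith)) (Real.rpow_nonneg (hφ.mem01 _).1 _)
      (Real.rpow_le_one (hφ.mem01 _).1 (hφ.mem01 _).2 hp)
  have hEin : ∀ ε y, 0 < ε → ε * ‖y‖ ≤ 1 → E ε y = Real.exp (-c * (ε ^ 2 * ‖y‖ ^ 2)) := by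
    intro ε y hε hy
    have : φ (emb N (ε • y)) = 1 := hφ.eq_one _ (by
      rw [mem_closedBall_zero_iff, norm_emb N h0, norm_smul, Real.norm_of_nonneg hε.le]
      exact hy)
    simp only [E, this, Real.one_rpow, mul_one]
  have hI := integrable_main N hN (xN0 N)
  have hID : Integrable (fun y => A / D y) := by
    refine (hI.const_mul A).mono' (Continuous.aestronglyMeasurable
      (continuous_const.div hDc fun y => (hD y).ne')) (Eventually.of_forall fun y => ?_)
    rw [Real.norm_of_nonneg (div_nonneg hApos (hD y).le), div_eq_mul_one_div]
    have : 1 / D y ≤ (1 + ‖y‖ ^ 2) / D y :=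
      div_le_div_of_nonneg_right (by nlinarith [norm_nonneg y]) (hD y).le
    exact mul_le_mul_of_nonneg_left this hApos
  have hIE : ∀ ε, Integrable (fun y => E ε y * (A / D y)) := fun ε => by
    refine hID.mono' (Continuous.aestronglyMeasurable
      ((hEc ε).mul (continuous_const.div hDc fun y => (hD y).ne')))
        (Eventually.of_forall fun y => ?_)
    have := div_nonneg hApos (hD y).le
    rw [Real.norm_of_nonneg (mul_nonneg (hE0 _ _) this)]
    exact mul_le_of_le_one_left this (hE1 _ _)
  have hIy : Integrable (fun y => ‖y‖ ^ 2 / D y) := by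
    refine hI.mono' (Continuous.aestronglyMeasurable
      ((by fun_prop : Continuous fun y : Euc (N-1) => ‖y‖ ^ 2).div hDc fun y => (hD y).ne'))
        (Eventually.of_forall fun y => ?_)
    rw [Real.norm_of_nonneg (div_nonneg (by positivity) (hD y).le)]
    exact div_le_div_of_nonneg_right (by linarith) (hD y).le
  have hK3 : Kthree N h0 = ∫ y, A / D y := by
    unfold Kthree
    congr 1
    funext y
    rw [Ubub_pow N hN h0 1 one_pos, div_pow]
    simp [D, hA]
  let F : ℝ → Euc (N - 1) → ℝ := fun ε y =>
    ((E ε y - 1) / ε ^ 2 + c * ‖y‖ ^ 2) * (A / D y)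
  have hrew : ∀ ε : ℝ, 0 < ε → ((∫ y : Euc (N - 1),
              Kw (emb N y) * (Ut N (by omega) φ ε (emb N y)) ^ twoStarL N)
            - Kthree N (by omega)
            + ((kN N ^ twoStarL N / (4 * ((N : ℝ) - 2))) *
                ∫ y : Euc (N - 1),
                  ‖y‖ ^ 2 / (1 + ‖y‖ ^ 2 + (xN0 N) ^ 2) ^ (N - 1)) * ε ^ 2)
          / ε ^ 2 = ∫ y, F ε y := by
    intro ε hε
    rw [integral_scaled N hN h0 φ hφ ε hε, hK3, kN_pow N hN, ← hA, ← hc]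
    have e1 : ∀ y, F ε y = (ε ^ 2)⁻¹ * (E ε y * (A / D y) - A / D y) + (A * c) * (‖y‖ ^ 2 / D y) := by
      intro y
      simp only [F]
      ring
    simp_rw [e1]
    have hsub : Integrable (fun y => (ε ^ 2)⁻¹ * (E ε y * (A / D y) - A / D y)) :=
      ((hIE ε).sub hID).const_mul _
    rw [integral_add hsub (hIy.const_mul _), integral_const_mul,
      integral_const_mul, integral_sub (hIE ε) hID]
    rw [show A / (4 * ((N:ℝ) - 2)) = A * c by rw [hc]; ring]
    have hfin : ∀ x y z : ℝ, (x - y + A * c * z * ε ^ 2) / ε ^ 2 =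
        (ε ^ 2)⁻¹ * (x - y) + A * c * z := fun x y z => by field_simp
    exact hfin _ _ _
  have hlim : Tendsto (fun ε => ∫ y, F ε y) (𝓝[>] (0:ℝ)) (𝓝 (∫ y : Euc (N-1), (0:ℝ))) := by
    refine tendsto_integral_filter_of_dominated_convergence
      (fun y => (2 * c + 1) * A * (‖y‖ ^ 2 / D y)) ?_ ?_ (hIy.const_mul _) ?_
    · refine Eventually.of_forall fun ε => Continuous.aestronglyMeasurable ?_
      have := hEc ε
      exact (by fun_prop : Continuous fun y => (E ε y - 1) / ε ^ 2 + c * ‖y‖ ^ 2).mul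
        (continuous_const.div hDc fun y => (hD y).ne')
    · filter_upwards [self_mem_nhdsWithin] with ε hε
      have hε : 0 < ε := hε
      refine Eventually.of_forall fun y => ?_
      have hAD := div_nonneg hApos (hD y).le
      have hb : |(E ε y - 1) / ε ^ 2 + c * ‖y‖ ^ 2| ≤ (2 * c + 1) * ‖y‖ ^ 2 := by
        have h1 : |(E ε y - 1) / ε ^ 2| ≤ (c + 1) * ‖y‖ ^ 2 := by
          rw [abs_div, abs_of_pos (by positivity : 0 < ε ^ 2), div_le_iff₀ (by positivity),
            abs_of_nonpos (by linarith [hE1 ε y])]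
          by_cases hy : ε * ‖y‖ ≤ 1
          · rw [hEin ε y hε hy]
            have := Real.add_one_le_exp (-c * (ε ^ 2 * ‖y‖ ^ 2))
            nlinarith [mul_nonneg (sq_nonneg ε) (sq_nonneg ‖y‖)]
          · push Not at hy
            have h3 : 1 ≤ (ε * ‖y‖) ^ 2 := one_le_pow₀ hy.le
            have := hE0 ε y
            have : 0 ≤ c * (ε * ‖y‖) ^ 2 := by positivity
            nlinarith
        have h2 : |c * ‖y‖ ^ 2| = c * ‖y‖ ^ 2 := abs_of_nonneg (by positivity)
        have := abs_add_le ((E ε y - 1) / ε ^ 2) (c * ‖y‖ ^ 2)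
        linarith
      simp only [F]
      rw [Real.norm_eq_abs, abs_mul, abs_of_nonneg hAD]
      calc _ ≤ (2 * c + 1) * ‖y‖ ^ 2 * (A / D y) := mul_le_mul_of_nonneg_right hb hAD
        _ = _ := by ring
    · refine Eventually.of_forall fun y => ?_
      have hd : HasDerivAt (fun t : ℝ => Real.exp (-c * (t * ‖y‖ ^ 2))) (-c * ‖y‖ ^ 2) 0 := by
        have h1 : HasDerivAt (fun t : ℝ => -c * (t * ‖y‖ ^ 2)) (-c * (1 * ‖y‖ ^ 2)) 0 :=
          ((hasDerivAt_id (0:ℝ)).mul_const _).const_mul _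
        simpa using h1.exp
      have hs := hd.tendsto_slope_zero_right
      have hsq : Tendsto (fun ε : ℝ => ε ^ 2) (𝓝[>] 0) (𝓝[>] 0) := by
        refine tendsto_nhdsWithin_iff.2 ⟨?_, ?_⟩
        · have : Tendsto (fun ε : ℝ => ε ^ 2) (𝓝 0) (𝓝 (0 ^ 2)) :=
            (continuous_pow 2).tendsto 0
          simpa using this.mono_left nhdsWithin_le_nhds
        · filter_upwards [self_mem_nhdsWithin] with ε hε
          have hε : 0 < ε := hε
          exact pow_pos hε 2
      have hs2 := hs.comp hsq
      have hs3 := (hs2.add_const (c * ‖y‖ ^ 2)).mul_const (A / D y)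
      rw [show (-c * ‖y‖ ^ 2 + c * ‖y‖ ^ 2) * (A / D y) = 0 by ring] at hs3
      refine hs3.congr' ?_
      have hsm : ∀ᶠ ε : ℝ in 𝓝[>] 0, ε * ‖y‖ < 1 := by
        have : Tendsto (fun ε : ℝ => ε * ‖y‖) (𝓝 0) (𝓝 (0 * ‖y‖)) :=
          (continuous_mul_const _).tendsto 0
        rw [zero_mul] at this
        exact (this.mono_left nhdsWithin_le_nhds).eventually_lt_const one_pos
      filter_upwards [self_mem_nhdsWithin, hsm] with ε hε hy
      simp only [F, Function.comp]
      rw [hEin ε y hε hy.le]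
      simp only [zero_add, zero_mul, mul_zero, Real.exp_zero, smul_eq_mul]
      ring
  rw [integral_zero] at hlim
  refine hlim.congr' ?_
  filter_upwards [self_mem_nhdsWithin] with ε hε
  exact (hrew ε hε).symm
end
end
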